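/- arXiv:hep-th/9308153 — 2 statements merged into one kernel-verified Lean document; each statement's English description precedes it below -/
import Mathlib

section
/- For all Laurent polynomials f, g ∈ ℂ[z,z⁻¹] and all m, n ∈ ℕ, the 2-cocycle Ψ on 𝒟 satisfies Ψ(f·∂_z^m, g·∂_z^n) = (m!·n!/(m+n+1)!)·Res_{z=0}(f^{(n+1)}(z)·g^{(m)}(z)), where f·∂_z^m denotes the composition of multiplication by f with the m-th formal derivative, f^{(j)} = ∂_z^j f, and Res_{z=0} h denotes the coefficient of z^{−1} in the Laurent polynomial h. -/
/-- The operator `z^k f(D)` on `ℂ[z,z⁻¹]` (Laurent polynomials realized as finitely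
supported functions `ℤ → ℂ` on the basis `z^n ↔ single n 1`): it sends `z^n` to
`f(n)·z^{n+k}`. -/
noncomputable def opE (k : ℤ) (f : Polynomial ℂ) : Module.End ℂ (ℤ →₀ ℂ) :=
  Finsupp.lsum ℂ fun n => Polynomial.eval ((n : ℤ) : ℂ) f • Finsupp.lsingle (n + k)

/-- Multiplication by the Laurent polynomial `e = Σ_m e_m z^m` as an endomorphism of
`ℂ[z,z⁻¹]`. -/
noncomputable def mulOp (e : ℤ →₀ ℂ) : Module.End ℂ (ℤ →₀ ℂ) :=
  e.sum fun m c => c • opE m 1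

/-- The formal derivative `∂_z` as an endomorphism of `ℂ[z,z⁻¹]`: `z^n ↦ n·z^{n-1}`. -/
noncomputable def derivOp : Module.End ℂ (ℤ →₀ ℂ) :=
  Finsupp.lsum ℂ fun n => ((n : ℤ) : ℂ) • Finsupp.lsingle (n - 1)

/-- The product of two Laurent polynomials (as finitely supported functions `ℤ → ℂ`). -/
noncomputable def laurMul (a b : ℤ →₀ ℂ) : ℤ →₀ ℂ :=
  a.sum fun m c => b.sum fun n d => Finsupp.single (m + n) (c * d)

/-- The formal derivative of a Laurent polynomial: `z^n ↦ n·z^{n-1}`. -/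
noncomputable def derivF (a : ℤ →₀ ℂ) : ℤ →₀ ℂ :=
  a.sum fun n c => Finsupp.single (n - 1) (((n : ℤ) : ℂ) * c)

/-- `Ψ` is a bilinear form satisfying the defining relations of the 2-cocycle of `𝒟`:
`Ψ(z^r f(D), z^{-r} g(D)) = Σ_{j=-r}^{-1} f(j)g(j+r)` for `r > 0` (below `j = i - r`),
the skew counterpart, and `Ψ(z^r f(D), z^s g(D)) = 0` if `r + s ≠ 0` or `r = s = 0`. -/
def RelPsi (Ψ : Module.End ℂ (ℤ →₀ ℂ) →ₗ[ℂ] Module.End ℂ (ℤ →₀ ℂ) →ₗ[ℂ] ℂ) : Prop :=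
  (∀ r : ℤ, 0 < r → ∀ f g : Polynomial ℂ,
    Ψ (opE r f) (opE (-r) g)
      = ∑ i ∈ Finset.range r.toNat,
          f.eval ((((i : ℤ) - r : ℤ)) : ℂ) * g.eval ((i : ℕ) : ℂ)) ∧
  (∀ r : ℤ, 0 < r → ∀ f g : Polynomial ℂ,
    Ψ (opE (-r) f) (opE r g)
      = - ∑ i ∈ Finset.range r.toNat,
          g.eval ((((i : ℤ) - r : ℤ)) : ℂ) * f.eval ((i : ℕ) : ℂ)) ∧
  (∀ r s : ℤ, r + s ≠ 0 → ∀ f g : Polynomial ℂ, Ψ (opE r f) (opE s g) = 0) ∧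
  (∀ f g : Polynomial ℂ, Ψ (opE 0 f) (opE 0 g) = 0)

lemma sum_range_choose_mul_choose (r m n : ℕ) :
    ∑ i ∈ Finset.range r, (r - 1 - i + m).choose m * i.choose n
      = (r + m).choose (m + n + 1) := by
  induction r generalizing m with
  | zero => simp [Nat.choose_eq_zero_of_lt (show m < m + n + 1 by omega)]
  | succ r ihr =>
    induction m with
    | zero =>
      have h := ihr 0
      simp only [Nat.choose_zero_right, one_mul, zero_add, add_zero] at h ⊢
      rw [Finset.sum_range_succ, h, Nat.choose_succ_succ' r n, add_comm]
    | succ m ihm =>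
      have hshift : ∑ i ∈ Finset.range (r + 1), (r - i + m).choose (m + 1) * i.choose n
          = (r + (m + 1)).choose (m + 1 + n + 1) := by
        rw [Finset.sum_range_succ, ← ihr (m + 1)]
        simp only [Nat.sub_self, zero_add, Nat.choose_succ_self, zero_mul, add_zero]
        refine Finset.sum_congr rfl fun i hi => ?_
        have := Finset.mem_range.1 hi
        rw [show r - 1 - i + (m + 1) = r - i + m by omega]
      calc ∑ i ∈ Finset.range (r + 1), (r + 1 - 1 - i + (m + 1)).choose (m + 1) * i.choose n
          = ∑ i ∈ Finset.range (r + 1), ((r + 1 - 1 - i + m).choose m * i.choose n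
              + (r - i + m).choose (m + 1) * i.choose n) := by
            refine Finset.sum_congr rfl fun i _ => ?_
            rw [← add_assoc, Nat.choose_succ_succ', add_mul, Nat.add_sub_cancel]
        _ = (r + 1 + (m + 1)).choose (m + 1 + n + 1) := by
            rw [Finset.sum_add_distrib, ihm, hshift,
              show r + 1 + (m + 1) = (r + 1 + m) + 1 by omega,
              show m + 1 + n + 1 = (m + n + 1) + 1 by omega, Nat.choose_succ_succ',
              show r + (m + 1) = r + 1 + m by omega]

lemma descPochhammer_eval_neg (m : ℕ) (x : ℂ) :
    (descPochhammer ℂ m).eval (-x) = (-1) ^ m * (descPochhammer ℂ m).eval (x + m - 1) := by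
  have h := ascPochhammer_eval_neg_eq_descPochhammer ℂ (-x) m
  rw [neg_neg] at h
  rw [descPochhammer_eval_eq_ascPochhammer ℂ (x + m - 1) m,
    show x + m - 1 - m + 1 = x by ring, h, ← mul_assoc, ← mul_pow]
  simp

lemma descPochhammer_eval_add (m n : ℕ) (x : ℂ) :
    (descPochhammer ℂ (m + n)).eval x
      = (descPochhammer ℂ m).eval x * (descPochhammer ℂ n).eval (x - m) := by
  rw [← descPochhammer_mul]
  simp

lemma descPochhammer_eval_natCast (m k : ℕ) :
    (descPochhammer ℂ m).eval (k : ℂ) = m.factorial * k.choose m := by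
  rw [descPochhammer_eval_eq_descFactorial, Nat.descFactorial_eq_factorial_mul_choose]
  push_cast
  rfl

lemma sum_descPochhammer_mul (r m n : ℕ) :
    ∑ i ∈ Finset.range r, (descPochhammer ℂ m).eval ((i : ℂ) - r)
        * (descPochhammer ℂ n).eval (i : ℂ)
      = (m.factorial * n.factorial / (m + n + 1).factorial)
          * ((-1) ^ m * (descPochhammer ℂ (m + n + 1)).eval ((r : ℂ) + m)) := by
  have hterm : ∀ i ∈ Finset.range r, (descPochhammer ℂ m).eval ((i : ℂ) - r)
        * (descPochhammer ℂ n).eval (i : ℂ)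
      = (-1) ^ m * m.factorial * n.factorial
          * (((r - 1 - i + m).choose m * i.choose n : ℕ) : ℂ) := by
    intro i hi
    have hi := Finset.mem_range.1 hi
    have hcast : (r : ℂ) - i + m - 1 = ((r - 1 - i + m : ℕ) : ℂ) := by
      obtain ⟨d, rfl⟩ := Nat.exists_eq_add_of_lt hi
      rw [show i + d + 1 - 1 - i + m = d + m by omega]
      push_cast
      ring
    rw [← neg_sub, descPochhammer_eval_neg, hcast, descPochhammer_eval_natCast,
      descPochhammer_eval_natCast]
    push_cast
    ring
  rw [Finset.sum_congr rfl hterm, ← Finset.mul_sum, ← Nat.cast_sum,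
    sum_range_choose_mul_choose, ← Nat.cast_add, descPochhammer_eval_natCast]
  have : ((m + n + 1).factorial : ℂ) ≠ 0 := Nat.cast_ne_zero.2 (Nat.factorial_ne_zero _)
  field_simp

lemma opE_single (k n : ℤ) (f : Polynomial ℂ) (c : ℂ) :
    opE k f (Finsupp.single n c) = Finsupp.single (n + k) (f.eval (n : ℂ) * c) := by
  simp [opE]

lemma derivOp_single (n : ℤ) (c : ℂ) :
    derivOp (Finsupp.single n c) = Finsupp.single (n - 1) ((n : ℂ) * c) := by
  simp [derivOp]

lemma derivOp_pow_single (m : ℕ) (k : ℤ) (c : ℂ) :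
    (derivOp ^ m) (Finsupp.single k c)
      = Finsupp.single (k - m) ((descPochhammer ℂ m).eval (k : ℂ) * c) := by
  induction m with
  | zero => simp
  | succ m ih =>
    rw [pow_succ', Module.End.mul_apply, ih, derivOp_single, descPochhammer_succ_eval]
    push_cast
    congr 1 <;> ring

lemma derivF_iterate (m : ℕ) (a : ℤ →₀ ℂ) : derivF^[m] a = (derivOp ^ m) a := by
  have h : derivF = derivOp := by
    ext1 a
    refine Finsupp.sum_congr fun n _ => ?_
    simp
  rw [h, Module.End.pow_apply]

lemma mulOp_add (f g : ℤ →₀ ℂ) : mulOp (f + g) = mulOp f + mulOp g :=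
  Finsupp.sum_add_index' (by simp) (by simp [add_smul])

lemma mulOp_single_mul_derivOp_pow (a : ℤ) (c : ℂ) (m : ℕ) :
    mulOp (Finsupp.single a c) * derivOp ^ m = c • opE (a - m) (descPochhammer ℂ m) := by
  refine Finsupp.lhom_ext fun k d => ?_
  rw [mulOp, Finsupp.sum_single_index (by simp), Module.End.mul_apply, derivOp_pow_single]
  simp only [LinearMap.smul_apply, opE_single]
  rw [Polynomial.eval_one, one_mul, show k - (m : ℤ) + a = k + (a - m) by ring]

lemma laurMul_add_left (a b c : ℤ →₀ ℂ) : laurMul (a + b) c = laurMul a c + laurMul b c :=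
  Finsupp.sum_add_index' (by simp) (by simp [add_mul])

lemma laurMul_add_right (a b c : ℤ →₀ ℂ) : laurMul a (b + c) = laurMul a b + laurMul a c := by
  unfold laurMul
  rw [← Finsupp.sum_add]
  refine Finsupp.sum_congr fun m _ => ?_
  exact Finsupp.sum_add_index' (by simp) (by simp [mul_add])

lemma laurMul_single_single (m n : ℤ) (c d : ℂ) :
    laurMul (Finsupp.single m c) (Finsupp.single n d) = Finsupp.single (m + n) (c * d) := by
  simp [laurMul]

lemma Psi_descPochhammer
    {Ψ : Module.End ℂ (ℤ →₀ ℂ) →ₗ[ℂ] Module.End ℂ (ℤ →₀ ℂ) →ₗ[ℂ] ℂ}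
    (hΨ : RelPsi Ψ) (r : ℤ) (m n : ℕ) :
    Ψ (opE r (descPochhammer ℂ m)) (opE (-r) (descPochhammer ℂ n))
      = (m.factorial * n.factorial / (m + n + 1).factorial)
          * ((descPochhammer ℂ (n + 1)).eval ((r : ℂ) + m)
            * (descPochhammer ℂ m).eval ((n : ℂ) - r)) := by
  obtain ⟨hpos, hneg, -, hzero⟩ := hΨ
  rcases lt_trichotomy r 0 with hr | rfl | hr
  · obtain ⟨t, rfl⟩ : ∃ t : ℕ, r = -t := ⟨(-r).toNat, by omega⟩
    have h := hneg t (by omega) (descPochhammer ℂ m) (descPochhammer ℂ n)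
    rw [Int.toNat_natCast] at h
    push_cast at h ⊢
    rw [neg_neg, h, sum_descPochhammer_mul, sub_neg_eq_add, neg_add_eq_sub, ← neg_sub,
      descPochhammer_eval_neg, show n + m + 1 = m + (n + 1) by ring,
      descPochhammer_eval_add m (n + 1), show m + (n + 1) = m + n + 1 by ring]
    push_cast
    rw [show (t : ℂ) - m + (n + 1) - 1 = t + n - m by ring, add_comm (n : ℂ) t]
    ring
  · rw [neg_zero, hzero]
    have h : (n + 1).factorial * m.choose (n + 1) * (m.factorial * n.choose m) = 0 := by
      rcases lt_or_ge m (n + 1) with h | h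
      · simp [Nat.choose_eq_zero_of_lt h]
      · simp [Nat.choose_eq_zero_of_lt (show n < m by omega)]
    simp only [Int.cast_zero, zero_add, sub_zero, descPochhammer_eval_natCast]
    rw [show (((n + 1).factorial : ℂ) * m.choose (n + 1) * (m.factorial * n.choose m)) = 0 by
      exact_mod_cast h, mul_zero]
  · obtain ⟨t, rfl⟩ : ∃ t : ℕ, r = t := ⟨r.toNat, by omega⟩
    have h := hpos t hr (descPochhammer ℂ m) (descPochhammer ℂ n)
    rw [Int.toNat_natCast] at h
    push_cast at h ⊢
    rw [h, sum_descPochhammer_mul, ← neg_sub (t : ℂ) n, descPochhammer_eval_neg,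
      show m + n + 1 = (n + 1) + m by ring, descPochhammer_eval_add (n + 1) m]
    push_cast
    rw [show (t : ℂ) + m - (n + 1) = t - n + m - 1 by ring]
    ring

/-- For all Laurent polynomials `f, g` and all `m, n ∈ ℕ`, the 2-cocycle `Ψ` on `𝒟`
satisfies
`Ψ(f·∂_z^m, g·∂_z^n) = (m!·n!/(m+n+1)!)·Res_{z=0}(f^{(n+1)}(z)·g^{(m)}(z))`,
where `Res_{z=0} h` is the coefficient of `z⁻¹` in `h`. -/
theorem Psi_eq_residue_formula
    (Ψ : Module.End ℂ (ℤ →₀ ℂ) →ₗ[ℂ] Module.End ℂ (ℤ →₀ ℂ) →ₗ[ℂ] ℂ)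
    (hΨ : RelPsi Ψ) (f g : ℤ →₀ ℂ) (m n : ℕ) :
    Ψ (mulOp f * derivOp ^ m) (mulOp g * derivOp ^ n)
      = ((m.factorial : ℂ) * (n.factorial : ℂ) / ((m + n + 1).factorial : ℂ))
          * (laurMul (derivF^[n + 1] f) (derivF^[m] g)) (-1) := by
  induction f using Finsupp.induction_linear with
  | zero => simp [mulOp, laurMul, derivF_iterate]
  | add f₁ f₂ h₁ h₂ =>
    rw [mulOp_add, add_mul, map_add, LinearMap.add_apply, h₁, h₂]
    simp only [derivF_iterate, map_add, laurMul_add_left, Finsupp.add_apply, mul_add]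
  | single a c =>
  induction g using Finsupp.induction_linear with
  | zero => simp [mulOp, laurMul, derivF_iterate]
  | add g₁ g₂ h₁ h₂ =>
    rw [mulOp_add, add_mul, map_add, h₁, h₂]
    simp only [derivF_iterate, map_add, laurMul_add_right, Finsupp.add_apply, mul_add]
  | single b d =>
  rw [mulOp_single_mul_derivOp_pow, mulOp_single_mul_derivOp_pow, derivF_iterate, derivF_iterate,
    derivOp_pow_single, derivOp_pow_single, laurMul_single_single]
  simp only [map_smul, LinearMap.smul_apply, smul_eq_mul]
  by_cases hab : (a - m) + (b - n) = 0
  · obtain rfl : b = n + m - a := by omega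
    rw [show (n : ℤ) + m - a - n = -(a - m) by ring, Psi_descPochhammer hΨ]
    push_cast
    rw [show a - ((n : ℤ) + 1) + (n + m - a - m) = -1 by ring, Finsupp.single_eq_same,
      show (a : ℂ) - m + m = a by ring, show (n : ℂ) - (a - m) = n + m - a by ring]
    ring
  · rw [hΨ.2.2.1 _ _ hab, Finsupp.single_eq_of_ne (by push_cast; omega)]
    simp
end

section
/- Let λ be a ℂ-linear functional on 𝒟̂_0 and let V be an irreducible highest weight 𝒟̂-module with highest weight λ and highest weight vector v_λ. Then the following conditions are equivalent: (i) the Verma module M(λ) is highly degenerate, i.e. contains a nonzero vector v of degree −1 with 𝒟̂_k·v = 0 for all k > 0; (ii) V is quasifinite; (iii) there exists a monic polynomial b ∈ ℂ[w] such that (z^{−1} b(D))·v_λ = 0 in V. -/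
/-- The Lie algebra `𝒟̂ = 𝒟 ⊕ ℂC`, modelled concretely: an element `Σ_k z^k f_k(D) + cC`
is the pair `(Σ_k single k f_k, c)` in `(ℤ →₀ ℂ[w]) × ℂ` (here `z^k f(D) ↔ single k f`). -/
abbrev DhatA : Type := (ℤ →₀ Polynomial ℂ) × ℂ

/-- The associative product of `𝒟ᵃ` in the model `ℤ →₀ ℂ[w]`:
`(z^k f(D))(z^m g(D)) = z^{k+m} f(D+m) g(D)`. -/
noncomputable def twMulD (x y : ℤ →₀ Polynomial ℂ) : ℤ →₀ Polynomial ℂ :=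
  x.sum fun k f => y.sum fun m g =>
    Finsupp.single (k + m) (f.comp (Polynomial.X + Polynomial.C (m : ℂ)) * g)

/-- The 2-cocycle `Ψ` of `𝒟`:
`Ψ(z^r f(D), z^{-r} g(D)) = Σ_{j=-r}^{-1} f(j)g(j+r)` for `r > 0` (below `j = i - r`),
skew-symmetry, and `Ψ(z^r f(D), z^s g(D)) = 0` if `r + s ≠ 0` or `r = s = 0`. -/
noncomputable def PsiD (x y : ℤ →₀ Polynomial ℂ) : ℂ :=
  x.sum fun r f => y.sum fun s g =>
    if 0 < r ∧ s = -r then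
      ∑ i ∈ Finset.range r.toNat,
        f.eval ((((i : ℤ) - r : ℤ)) : ℂ) * g.eval ((i : ℕ) : ℂ)
    else if 0 < s ∧ r = -s then
      -(∑ i ∈ Finset.range s.toNat,
        g.eval ((((i : ℤ) - s : ℤ)) : ℂ) * f.eval ((i : ℕ) : ℂ))
    else 0

/-- The bracket of `𝒟̂`: `[a, b] = ab - ba + Ψ(a,b)·C` for `a, b ∈ 𝒟`, with `C` central. -/
noncomputable def hatBracket (x y : DhatA) : DhatA :=
  (twMulD x.1 y.1 - twMulD y.1 x.1, PsiD x.1 y.1)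

/-- A parabolic subalgebra of `𝒟̂`: a graded Lie subalgebra `𝔭 = ⊕_j 𝔭_j` with
`𝔭_j = 𝒟̂_j` for all `j ≥ 0` (in particular `ℂC ⊆ 𝔭`) and `𝔭_j ≠ 0` for some `j < 0`. -/
structure IsParabolic (p : Submodule ℂ DhatA) : Prop where
  /-- `𝔭` is closed under the bracket of `𝒟̂`. -/
  closed : ∀ x ∈ p, ∀ y ∈ p, hatBracket x y ∈ p
  /-- `𝔭` is graded: the degree-`j` component of any element of `𝔭` lies in `𝔭`. -/
  graded : ∀ x ∈ p, ∀ j : ℤ,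
    ((Finsupp.single j (x.1 j), if j = 0 then x.2 else 0) : DhatA) ∈ p
  /-- `𝔭_j = 𝒟̂_j` for `j ≥ 0`. -/
  nonneg : ∀ j : ℤ, 0 ≤ j → ∀ f : Polynomial ℂ, ((Finsupp.single j f, 0) : DhatA) ∈ p
  /-- `C ∈ 𝔭` (part of `𝔭_0 = 𝒟̂_0`). -/
  central_mem : ∀ c : ℂ, (((0 : ℤ →₀ Polynomial ℂ), c) : DhatA) ∈ p
  /-- `𝔭_j ≠ 0` for some `j < 0`. -/
  neg : ∃ (j : ℤ) (f : Polynomial ℂ), j < 0 ∧ f ≠ 0 ∧ ((Finsupp.single j f, 0) : DhatA) ∈ p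

/-- A highest weight module over `𝒟̂` with highest weight `λ` (given by the functional
`lam` on `𝒟_0 = ℂ[w]`, `λ(f(D)) = lam f`, and the central charge `cc = λ(C)`):
a `ℤ`-graded `𝒟̂`-module `M = ⊕_{j≤0} M_j` (action `ρ`, grading `g`) generated by a
highest weight vector `v` with `𝒟̂_+ · v = 0`. -/
structure IsHWModule {M : Type*} [AddCommGroup M] [Module ℂ M]
    (lam : Polynomial ℂ →ₗ[ℂ] ℂ) (cc : ℂ)
    (ρ : DhatA →ₗ[ℂ] Module.End ℂ M) (g : ℤ → Submodule ℂ M) (v : M) : Prop where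
  /-- `ρ` is a Lie algebra action of `𝒟̂`. -/
  rep : ∀ x y : DhatA, ρ (hatBracket x y) = ρ x * ρ y - ρ y * ρ x
  /-- the action is compatible with the gradations: `𝒟̂_k · M_j ⊆ M_{j+k}` -/
  graded_act : ∀ (k : ℤ) (f : Polynomial ℂ) (j : ℤ),
    Submodule.map (ρ (Finsupp.single k f, 0)) (g j) ≤ g (j + k)
  central_act : ∀ (c : ℂ) (j : ℤ),
    Submodule.map (ρ ((0 : ℤ →₀ Polynomial ℂ), c)) (g j) ≤ g j
  /-- `M` is the direct sum of the `M_j` -/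
  indep : ∀ j : ℤ, g j ⊓ (⨆ (i : ℤ) (_ : i ≠ j), g i) = ⊥
  total : (⨆ j : ℤ, g j) = ⊤
  /-- `M_j = 0` for `j > 0` -/
  posbot : ∀ j : ℤ, 0 < j → g j = ⊥
  /-- `M_0 = ℂ·v` with `v ≠ 0` -/
  v_mem : v ∈ g 0
  v_ne : v ≠ 0
  v_span : g 0 = Submodule.span ℂ {v}
  /-- `h·v = λ(h)·v` for `h ∈ 𝒟̂_0` -/
  weight : ∀ (f : Polynomial ℂ) (a : ℂ),
    ρ (Finsupp.single 0 f, a) v = (lam f + a * cc) • v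
  /-- `𝒟̂_+ · v = 0` -/
  hw_ann : ∀ k : ℤ, 0 < k → ∀ f : Polynomial ℂ, ρ (Finsupp.single k f, 0) v = 0
  /-- `M` is generated by `v` -/
  gen : ∀ W : Submodule ℂ M, v ∈ W →
    (∀ x : DhatA, Submodule.map (ρ x) W ≤ W) → W = ⊤

/-- Irreducibility: the only `ℤ`-graded `𝒟̂`-submodules are `0` and the whole module. -/
def IsIrreducibleGraded {M : Type*} [AddCommGroup M] [Module ℂ M]
    (ρ : DhatA →ₗ[ℂ] Module.End ℂ M) (g : ℤ → Submodule ℂ M) : Prop :=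
  ∀ W : Submodule ℂ M, (∀ x : DhatA, Submodule.map (ρ x) W ≤ W) →
    W = (⨆ j : ℤ, W ⊓ g j) → W = ⊥ ∨ W = ⊤

open Polynomial in
lemma twMulD_single_single (k m : ℤ) (f g : ℂ[X]) :
    twMulD (Finsupp.single k f) (Finsupp.single m g) =
      Finsupp.single (k + m) (f.comp (X + C (m : ℂ)) * g) := by
  simp [twMulD, Finsupp.sum_single_index]

lemma twMulD_add_left (x y z : ℤ →₀ Polynomial ℂ) :
    twMulD (x + y) z = twMulD x z + twMulD y z := by
  unfold twMulD
  refine Finsupp.sum_add_index' (by simp) fun k f₁ f₂ => ?_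
  simp [add_mul, Finsupp.sum_add]

lemma twMulD_add_right (x y z : ℤ →₀ Polynomial ℂ) :
    twMulD x (y + z) = twMulD x y + twMulD x z := by
  unfold twMulD
  rw [← Finsupp.sum_add]
  refine Finsupp.sum_congr fun k _ => ?_
  exact Finsupp.sum_add_index' (by simp) fun m g₁ g₂ => by simp [mul_add]

lemma PsiD_single_single_of_add_ne_zero {k m : ℤ} (h : k + m ≠ 0) (f g : Polynomial ℂ) :
    PsiD (Finsupp.single k f) (Finsupp.single m g) = 0 := by
  unfold PsiD
  rw [Finsupp.sum_single_index (by simp), Finsupp.sum_single_index (by simp),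
    if_neg (by omega), if_neg (by omega)]

open Polynomial in
lemma hatBracket_single_single (k m : ℤ) (f g : ℂ[X]) :
    hatBracket (Finsupp.single k f, 0) (Finsupp.single m g, 0) =
      (Finsupp.single (k + m) (f.comp (X + C (m : ℂ)) * g - g.comp (X + C (k : ℂ)) * f),
        PsiD (Finsupp.single k f) (Finsupp.single m g)) := by
  simp [hatBracket, twMulD_single_single, add_comm m k]

open Polynomial in
lemma hatBracket_single_single_of_add_ne_zero {k m : ℤ} (h : k + m ≠ 0) (f g : ℂ[X]) :
    hatBracket (Finsupp.single k f, 0) (Finsupp.single m g, 0) =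
      (Finsupp.single (k + m) (f.comp (X + C (m : ℂ)) * g - g.comp (X + C (k : ℂ)) * f), 0) := by
  rw [hatBracket_single_single, PsiD_single_single_of_add_ne_zero h]

lemma hatBracket_central_left (c : ℂ) (x : DhatA) : hatBracket (0, c) x = 0 := by
  simp [hatBracket, twMulD, PsiD]

section Representation

variable {E : Type*} [AddCommGroup E] [Module ℂ E] {ρ : DhatA →ₗ[ℂ] Module.End ℂ E}

lemma action_mem_of_homogeneous {P Q : Submodule ℂ E}
    (hs : ∀ (k : ℤ) (f : Polynomial ℂ), ∀ u ∈ P, ρ (Finsupp.single k f, 0) u ∈ Q)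
    (hc : ∀ c : ℂ, ∀ u ∈ P, ρ (0, c) u ∈ Q) (x : DhatA) : ∀ u ∈ P, ρ x u ∈ Q := by
  intro u hu
  obtain ⟨y, c⟩ := x
  have h : ((y, c) : DhatA) = (y, 0) + (0, c) := by simp
  rw [h, map_add, LinearMap.add_apply]
  refine Q.add_mem ?_ (hc c u hu)
  induction y using Finsupp.induction_linear with
  | zero => exact hc 0 u hu
  | add a b ha hb =>
    have h : ((a + b, 0) : DhatA) = (a, 0) + (b, 0) := by simp
    rw [h, map_add, LinearMap.add_apply]
    exact Q.add_mem (ha (by simp)) (hb (by simp))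
  | single k f => exact hs k f u hu

variable (hrep : ∀ x y : DhatA, ρ (hatBracket x y) = ρ x * ρ y - ρ y * ρ x)

include hrep in
lemma action_comm (x y : DhatA) (u : E) :
    ρ x (ρ y u) = ρ y (ρ x u) + ρ (hatBracket x y) u := by
  rw [hrep]; simp

/-- The span of the words of length at most `n` in `⊕_{k<0} 𝒟̂_k` applied to `Y`. -/
noncomputable def lowerFiltration (ρ : DhatA →ₗ[ℂ] Module.End ℂ E) (Y : Submodule ℂ E) :
    ℕ → Submodule ℂ E
  | 0 => Y
  | n + 1 => lowerFiltration ρ Y n ⊔ Submodule.span ℂ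
      {y | ∃ k < (0 : ℤ), ∃ f : Polynomial ℂ, ∃ u ∈ lowerFiltration ρ Y n,
        y = ρ (Finsupp.single k f, 0) u}

lemma lowerFiltration_mono (Y : Submodule ℂ E) : Monotone (lowerFiltration ρ Y) :=
  monotone_nat_of_le_succ fun _ => le_sup_left

lemma lower_mem_lowerFiltration {Y : Submodule ℂ E} {n : ℕ} {k : ℤ} (hk : k < 0)
    (f : Polynomial ℂ) {u : E} (hu : u ∈ lowerFiltration ρ Y n) :
    ρ (Finsupp.single k f, 0) u ∈ lowerFiltration ρ Y (n + 1) :=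
  Submodule.mem_sup_right (Submodule.subset_span ⟨k, hk, f, u, hu, rfl⟩)

lemma mem_of_mem_lowerFiltration_succ {Y Q : Submodule ℂ E} {n : ℕ} {A : Module.End ℂ E}
    (h₁ : ∀ u ∈ lowerFiltration ρ Y n, A u ∈ Q)
    (h₂ : ∀ k < (0 : ℤ), ∀ f : Polynomial ℂ, ∀ u ∈ lowerFiltration ρ Y n,
      A (ρ (Finsupp.single k f, 0) u) ∈ Q) :
    ∀ u ∈ lowerFiltration ρ Y (n + 1), A u ∈ Q := by
  have h : lowerFiltration ρ Y (n + 1) ≤ Q.comap A := by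
    refine sup_le h₁ (Submodule.span_le.2 ?_)
    rintro _ ⟨k, hk, f, u, hu, rfl⟩
    exact h₂ k hk f u hu
  exact h

include hrep in
lemma central_mem_lowerFiltration {Y : Submodule ℂ E}
    (hY : ∀ c : ℂ, ∀ u ∈ Y, ρ (0, c) u ∈ Y) (n : ℕ) (c : ℂ) :
    ∀ u ∈ lowerFiltration ρ Y n, ρ (0, c) u ∈ lowerFiltration ρ Y n := by
  induction n with
  | zero => exact hY c
  | succ n ih =>
    refine mem_of_mem_lowerFiltration_succ
      (fun u hu => lowerFiltration_mono Y n.le_succ (ih u hu)) fun k hk f u hu => ?_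
    rw [action_comm hrep, hatBracket_central_left, map_zero, LinearMap.zero_apply, add_zero]
    exact lower_mem_lowerFiltration hk f (ih u hu)

include hrep in
lemma nonneg_mem_lowerFiltration {Y : Submodule ℂ E}
    (hc : ∀ c : ℂ, ∀ u ∈ Y, ρ (0, c) u ∈ Y)
    (hY : ∀ k : ℤ, 0 ≤ k → ∀ f : Polynomial ℂ, ∀ u ∈ Y, ρ (Finsupp.single k f, 0) u ∈ Y)
    (n : ℕ) : ∀ k : ℤ, 0 ≤ k → ∀ f : Polynomial ℂ, ∀ u ∈ lowerFiltration ρ Y n,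
      ρ (Finsupp.single k f, 0) u ∈ lowerFiltration ρ Y n := by
  induction n with
  | zero => exact hY
  | succ n ih =>
    intro k hk f
    refine mem_of_mem_lowerFiltration_succ
      (fun u hu => lowerFiltration_mono Y n.le_succ (ih k hk f u hu)) fun l hl g u hu => ?_
    rw [action_comm hrep]
    refine Submodule.add_mem _ (lower_mem_lowerFiltration hl g (ih k hk f u hu)) ?_
    rw [hatBracket_single_single]
    generalize PsiD _ _ = c
    generalize (_ - _ : Polynomial ℂ) = p
    have h : ((Finsupp.single (k + l) p, c) : DhatA) =
      (Finsupp.single (k + l) p, 0) + (0, c) := by simp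
    rw [h, map_add, LinearMap.add_apply]
    refine Submodule.add_mem _ ?_ (lowerFiltration_mono Y n.le_succ
      (central_mem_lowerFiltration hrep hc n c u hu))
    rcases lt_or_ge (k + l) 0 with h | h
    · exact lower_mem_lowerFiltration h p hu
    · exact lowerFiltration_mono Y n.le_succ (ih _ h p u hu)

include hrep in
/-- If `Y` is stable under `⊕_{k≥0} 𝒟̂_k`, then any subspace containing `Y` and stable under
`⊕_{k<0} 𝒟̂_k` contains a `𝒟̂`-submodule containing `Y`. -/
lemma exists_invariant_le {Y T : Submodule ℂ E}
    (hc : ∀ c : ℂ, ∀ u ∈ Y, ρ (0, c) u ∈ Y)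
    (hY : ∀ k : ℤ, 0 ≤ k → ∀ f : Polynomial ℂ, ∀ u ∈ Y, ρ (Finsupp.single k f, 0) u ∈ Y)
    (hYT : Y ≤ T)
    (hT : ∀ k < (0 : ℤ), ∀ f : Polynomial ℂ, ∀ u ∈ T, ρ (Finsupp.single k f, 0) u ∈ T) :
    ∃ Q : Submodule ℂ E, Y ≤ Q ∧ Q ≤ T ∧ ∀ x : DhatA, ∀ u ∈ Q, ρ x u ∈ Q := by
  have hmem (u : E) : u ∈ ⨆ n, lowerFiltration ρ Y n ↔ ∃ n, u ∈ lowerFiltration ρ Y n :=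
    Submodule.mem_iSup_of_directed _ (lowerFiltration_mono Y).directed_le
  refine ⟨⨆ n, lowerFiltration ρ Y n, le_iSup (lowerFiltration ρ Y) 0, iSup_le fun n => ?_, ?_⟩
  · induction n with
    | zero => exact hYT
    | succ n ih =>
      refine sup_le ih (Submodule.span_le.2 ?_)
      rintro _ ⟨k, hk, f, u, hu, rfl⟩
      exact hT k hk f u (ih hu)
  · refine action_mem_of_homogeneous (fun k f u hu => ?_) fun c u hu => ?_
    · obtain ⟨n, hn⟩ := (hmem u).1 hu
      rcases lt_or_ge k 0 with h | h
      · exact (hmem _).2 ⟨n + 1, lower_mem_lowerFiltration h f hn⟩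
      · exact (hmem _).2 ⟨n, nonneg_mem_lowerFiltration hrep hc hY n k h f u hn⟩
    · obtain ⟨n, hn⟩ := (hmem u).1 hu
      exact (hmem _).2 ⟨n, central_mem_lowerFiltration hrep hc n c u hn⟩

end Representation

/-- A family of subspaces contained in an independent family and spanning the whole space
coincides with it. -/
lemma eq_of_le_of_iSup_eq_top {E : Type*} [AddCommGroup E] [Module ℂ E]
    {G g : ℤ → Submodule ℂ E} (hle : ∀ j, G j ≤ g j) (htop : ⨆ j, G j = ⊤)
    (hind : ∀ j : ℤ, g j ⊓ (⨆ (i : ℤ) (_ : i ≠ j), g i) = ⊥) (j : ℤ) : g j = G j := by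
  refine le_antisymm ?_ (hle j)
  have h : (⊤ : Submodule ℂ E) ≤ G j ⊔ ⨆ (i : ℤ) (_ : i ≠ j), g i := by
    rw [← htop]
    refine iSup_le fun i => ?_
    by_cases hi : i = j
    · exact hi ▸ le_sup_left
    · exact le_sup_of_le_right ((hle i).trans (le_iSup₂_of_le i hi le_rfl))
  calc g j = (G j ⊔ ⨆ (i : ℤ) (_ : i ≠ j), g i) ⊓ g j := by rw [top_le_iff.1 h, top_inf_eq]
    _ = G j ⊔ (⨆ (i : ℤ) (_ : i ≠ j), g i) ⊓ g j := sup_inf_assoc_of_le _ (hle j)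
    _ ≤ G j := by rw [inf_comm, hind, sup_bot_eq]

section HighestWeight

variable {E : Type*} [AddCommGroup E] [Module ℂ E] {ρ : DhatA →ₗ[ℂ] Module.End ℂ E}
  {lam : Polynomial ℂ →ₗ[ℂ] ℂ} {cc : ℂ} {v : E}

lemma PsiD_single_zero_left (k : ℤ) (f g : Polynomial ℂ) :
    PsiD (Finsupp.single 0 f) (Finsupp.single k g) = 0 := by
  unfold PsiD
  rw [Finsupp.sum_single_index (by simp), Finsupp.sum_single_index (by simp),
    if_neg (by omega), if_neg (by omega)]

lemma eq_top_of_lower_stable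
    (hrep : ∀ x y : DhatA, ρ (hatBracket x y) = ρ x * ρ y - ρ y * ρ x)
    (weight : ∀ (f : Polynomial ℂ) (a : ℂ),
      ρ (Finsupp.single 0 f, a) v = (lam f + a * cc) • v)
    (hw_ann : ∀ k : ℤ, 0 < k → ∀ f : Polynomial ℂ, ρ (Finsupp.single k f, 0) v = 0)
    (gen : ∀ W : Submodule ℂ E, v ∈ W →
      (∀ x : DhatA, Submodule.map (ρ x) W ≤ W) → W = ⊤)
    {T : Submodule ℂ E} (hv : v ∈ T)
    (hT : ∀ k < (0 : ℤ), ∀ f : Polynomial ℂ, ∀ u ∈ T, ρ (Finsupp.single k f, 0) u ∈ T) :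
    T = ⊤ := by
  have hweight (f : Polynomial ℂ) (a : ℂ) :
      ∀ u ∈ Submodule.span ℂ {v}, ρ (Finsupp.single 0 f, a) u ∈ Submodule.span ℂ {v} := by
    intro u hu
    obtain ⟨t, rfl⟩ := Submodule.mem_span_singleton.1 hu
    rw [map_smul, weight]
    exact Submodule.smul_mem _ _ (Submodule.smul_mem _ _ (Submodule.mem_span_singleton_self v))
  obtain ⟨Q, hvQ, hQT, hQ⟩ := exists_invariant_le (Y := Submodule.span ℂ {v}) (T := T) hrep
    (fun c => by simpa using hweight 0 c)
    (fun k hk f u hu => by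
      rcases hk.eq_or_lt with rfl | hk
      · exact hweight f 0 u hu
      · obtain ⟨t, rfl⟩ := Submodule.mem_span_singleton.1 hu
        simp [hw_ann k hk f])
    ((Submodule.span_singleton_le_iff_mem _ _).2 hv) hT
  have h := gen Q (hvQ (Submodule.mem_span_singleton_self v))
    fun x => Submodule.map_le_iff_le_comap.2 (hQ x)
  exact top_le_iff.1 (h ▸ hQT)

open Polynomial in
/-- A module generated by a highest weight vector is a highest weight module, graded by the
eigenspaces of the energy operator `D`. -/
lemma isHWModule_eigenspace
    (hrep : ∀ x y : DhatA, ρ (hatBracket x y) = ρ x * ρ y - ρ y * ρ x)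
    (v_ne : v ≠ 0)
    (weight : ∀ (f : ℂ[X]) (a : ℂ), ρ (Finsupp.single 0 f, a) v = (lam f + a * cc) • v)
    (hw_ann : ∀ k : ℤ, 0 < k → ∀ f : ℂ[X], ρ (Finsupp.single k f, 0) v = 0)
    (gen : ∀ W : Submodule ℂ E, v ∈ W →
      (∀ x : DhatA, Submodule.map (ρ x) W ≤ W) → W = ⊤) :
    IsHWModule lam cc ρ
      (fun j => (ρ (Finsupp.single 0 X, 0)).eigenspace (lam X + j)) v := by
  set g : ℤ → Submodule ℂ E := fun j => (ρ (Finsupp.single 0 X, 0)).eigenspace (lam X + j)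
  have mem_g (j : ℤ) (u : E) :
      u ∈ g j ↔ ρ (Finsupp.single 0 X, 0) u = (lam X + j) • u :=
    Module.End.mem_eigenspace_iff
  have v_mem : v ∈ g 0 := by simp [mem_g, weight]
  have shift (k : ℤ) (f : ℂ[X]) (j : ℤ) (u : E) (hu : u ∈ g j) :
      ρ (Finsupp.single k f, 0) u ∈ g (j + k) := by
    rw [mem_g] at hu ⊢
    have h : hatBracket (Finsupp.single 0 X, 0) (Finsupp.single k f, 0) =
        (k : ℂ) • ((Finsupp.single k f, 0) : DhatA) := by
      rw [hatBracket_single_single, PsiD_single_zero_left]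
      have : (X : ℂ[X]).comp (X + C (k : ℂ)) * f - f.comp (X + C ((0 : ℤ) : ℂ)) * X
          = (k : ℂ) • f := by
        simp [smul_eq_C_mul]; ring
      rw [this, zero_add]
      simp
    rw [action_comm hrep, hu, h]
    simp only [map_smul, LinearMap.smul_apply, Int.cast_add]
    rw [← add_smul, add_assoc]
  have indep : iSupIndep g := by
    refine (Module.End.eigenspaces_iSupIndep (ρ (Finsupp.single 0 X, 0))).comp
      (f := fun j : ℤ => lam X + (j : ℂ)) fun i j h => ?_
    simpa using h
  have indep' (j : ℤ) : g j ⊓ (⨆ (i : ℤ) (_ : i ≠ j), g i) = ⊥ := (indep j).eq_bot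
  set G : ℤ → Submodule ℂ E :=
    fun j => if j = 0 then Submodule.span ℂ {v} else if j < 0 then g j else ⊥ with hG
  have hGg (j : ℤ) : G j ≤ g j := by
    simp only [hG]
    split_ifs with h₀ h₁
    · subst h₀
      exact (Submodule.span_singleton_le_iff_mem _ _).2 v_mem
    · exact le_rfl
    · exact bot_le
  have htop : ⨆ j, G j = ⊤ := by
    refine eq_top_of_lower_stable hrep weight hw_ann gen
      (Submodule.mem_iSup_of_mem 0 (by simp [hG])) fun k hk f => ?_
    change ⨆ j, G j ≤ (⨆ j, G j).comap (ρ (Finsupp.single k f, 0))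
    refine iSup_le fun j u hu => ?_
    rcases lt_or_ge 0 j with hj | hj
    · have : u = 0 := by simpa [hG, hj.ne', hj.not_gt] using hu
      simp [this]
    · refine Submodule.mem_iSup_of_mem (j + k) ?_
      have h₁ : j + k ≠ 0 := by omega
      have h₂ : j + k < 0 := by omega
      simpa [hG, h₁, h₂] using shift k f j u (hGg j hu)
  have hgG := eq_of_le_of_iSup_eq_top hGg htop indep'
  refine ⟨hrep, fun k f j => Submodule.map_le_iff_le_comap.2 (shift k f j),
    fun c j => Submodule.map_le_iff_le_comap.2 fun u hu => ?_, indep',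
    top_le_iff.1 (htop ▸ iSup_mono hGg), fun j hj => ?_, v_mem, v_ne, ?_, weight, hw_ann, gen⟩
  · rw [mem_g] at hu
    have h := action_comm hrep (0, c) (Finsupp.single 0 X, 0) u
    rw [hatBracket_central_left, map_zero, LinearMap.zero_apply, add_zero, hu, map_smul] at h
    exact (mem_g j _).2 h.symm
  · rw [hgG]; simp [hG, hj.ne', hj.not_gt]
  · rw [hgG]; simp [hG]

end HighestWeight

namespace IsHWModule

variable {E : Type*} [AddCommGroup E] [Module ℂ E] {ρ : DhatA →ₗ[ℂ] Module.End ℂ E}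
  {lam : Polynomial ℂ →ₗ[ℂ] ℂ} {cc : ℂ} {g : ℤ → Submodule ℂ E} {v : E}

lemma mem_shift (h : IsHWModule lam cc ρ g v) (k : ℤ) (f : Polynomial ℂ) {j : ℤ} {u : E}
    (hu : u ∈ g j) : ρ (Finsupp.single k f, 0) u ∈ g (j + k) :=
  h.graded_act k f j (Submodule.mem_map_of_mem hu)

lemma central_mem (h : IsHWModule lam cc ρ g v) (c : ℂ) {j : ℤ} {u : E}
    (hu : u ∈ g j) : ρ (0, c) u ∈ g j :=
  h.central_act c j (Submodule.mem_map_of_mem hu)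

lemma eq_top_of_lower_stable (h : IsHWModule lam cc ρ g v) {T : Submodule ℂ E} (hv : v ∈ T)
    (hT : ∀ k < (0 : ℤ), ∀ f : Polynomial ℂ, ∀ u ∈ T, ρ (Finsupp.single k f, 0) u ∈ T) :
    T = ⊤ :=
  _root_.eq_top_of_lower_stable h.rep h.weight h.hw_ann h.gen hv hT

lemma eq_span_lower (h : IsHWModule lam cc ρ g v) {j : ℤ} (hj : j < 0) :
    g j = Submodule.span ℂ {y | ∃ k < (0 : ℤ), ∃ f : Polynomial ℂ, ∃ u ∈ g (j - k),
      y = ρ (Finsupp.single k f, 0) u} := by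
  set L : ℤ → Submodule ℂ E := fun j =>
    Submodule.span ℂ {y | ∃ k < (0 : ℤ), ∃ f : Polynomial ℂ, ∃ u ∈ g (j - k),
      y = ρ (Finsupp.single k f, 0) u} with hL
  have hLg (j : ℤ) : L j ≤ g j := by
    refine Submodule.span_le.2 ?_
    rintro _ ⟨k, -, f, u, hu, rfl⟩
    simpa using h.mem_shift k f hu
  set G : ℤ → Submodule ℂ E := fun j => if j = 0 then Submodule.span ℂ {v} else L j with hG
  have hGg (j : ℤ) : G j ≤ g j := by
    simp only [hG]
    split_ifs with h₀
    · rw [h₀, h.v_span]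
    · exact hLg j
  have htop : ⨆ j, G j = ⊤ := by
    refine h.eq_top_of_lower_stable
      (Submodule.mem_iSup_of_mem 0 (by simp [hG])) fun k hk f => ?_
    change ⨆ j, G j ≤ (⨆ j, G j).comap (ρ (Finsupp.single k f, 0))
    refine iSup_le fun j u hu => ?_
    have hug := hGg j hu
    rcases lt_or_ge 0 j with hj | hj
    · rw [h.posbot j hj, Submodule.mem_bot] at hug
      simp [hug]
    · refine Submodule.mem_iSup_of_mem (j + k) ?_
      have h₁ : j + k ≠ 0 := by omega
      simp only [hG, h₁, if_false]
      exact Submodule.subset_span ⟨k, hk, f, u, by simpa using hug, rfl⟩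
  have := eq_of_le_of_iSup_eq_top hGg htop h.indep j
  simpa [hG, hj.ne] using this

/-- The linear map `f ↦ z^k f(D)·u`. -/
noncomputable def orbitMap (ρ : DhatA →ₗ[ℂ] Module.End ℂ E) (k : ℤ) (u : E) :
    Polynomial ℂ →ₗ[ℂ] E :=
  (LinearMap.applyₗ u) ∘ₗ ρ ∘ₗ LinearMap.inl ℂ _ ℂ ∘ₗ Finsupp.lsingle k

lemma orbitMap_apply (k : ℤ) (u : E) (f : Polynomial ℂ) :
    orbitMap ρ k u f = ρ (Finsupp.single k f, 0) u := rfl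

lemma exists_of_mem_neg_one (h : IsHWModule lam cc ρ g v) {u : E} (hu : u ∈ g (-1)) :
    ∃ b : Polynomial ℂ, u = ρ (Finsupp.single (-1) b, 0) v := by
  have hle : g (-1) ≤ LinearMap.range (orbitMap ρ (-1) v) := by
    rw [h.eq_span_lower (by norm_num)]
    refine Submodule.span_le.2 ?_
    rintro _ ⟨k, hk, f, u, hu, rfl⟩
    rcases eq_or_ne k (-1) with rfl | hk'
    · rw [sub_self, h.v_span] at hu
      obtain ⟨t, rfl⟩ := Submodule.mem_span_singleton.1 hu
      refine ⟨t • f, ?_⟩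
      rw [map_smul, map_smul, orbitMap_apply]
    · rw [h.posbot _ (by omega), Submodule.mem_bot] at hu
      simp [hu]
  obtain ⟨b, hb⟩ := hle hu
  exact ⟨b, hb.symm⟩

open Polynomial in
lemma raise_lower_one (h : IsHWModule lam cc ρ g v) (f b : ℂ[X]) :
    ρ (Finsupp.single 1 f, 0) (ρ (Finsupp.single (-1) b, 0) v) =
      (lam (f.comp (X + C (((-1 : ℤ)) : ℂ)) * b - b.comp (X + C ((1 : ℤ) : ℂ)) * f) +
        PsiD (Finsupp.single 1 f) (Finsupp.single (-1) b) * cc) • v := by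
  rw [action_comm h.rep, h.hw_ann 1 one_pos, map_zero, zero_add, hatBracket_single_single,
    add_neg_cancel, h.weight]

lemma raise_eq_zero (h : IsHWModule lam cc ρ g v) {k : ℤ} (hk : 1 < k) (f : Polynomial ℂ)
    {u : E} (hu : u ∈ g (-1)) : ρ (Finsupp.single k f, 0) u = 0 := by
  have := h.mem_shift k f hu
  rwa [h.posbot _ (by omega), Submodule.mem_bot] at this

lemma lower_mem (h : IsHWModule lam cc ρ g v) (b : Polynomial ℂ) :
    ρ (Finsupp.single (-1) b, 0) v ∈ g (-1) := by
  simpa using h.mem_shift (-1) b h.v_mem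

/-- Whether `z^{-1}b(D)·v` is singular depends only on the highest weight. -/
lemma singular_of_singular {N : Type*} [AddCommGroup N] [Module ℂ N]
    {ρ' : DhatA →ₗ[ℂ] Module.End ℂ N} {g' : ℤ → Submodule ℂ N} {v' : N}
    (h : IsHWModule lam cc ρ g v) (h' : IsHWModule lam cc ρ' g' v') {b : Polynomial ℂ}
    (hs : ∀ k : ℤ, 0 < k → ∀ f : Polynomial ℂ,
      ρ (Finsupp.single k f, 0) (ρ (Finsupp.single (-1) b, 0) v) = 0)
    (k : ℤ) (hk : 0 < k) (f : Polynomial ℂ) :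
    ρ' (Finsupp.single k f, 0) (ρ' (Finsupp.single (-1) b, 0) v') = 0 := by
  rcases eq_or_ne k 1 with rfl | hk₁
  · have := hs 1 one_pos f
    rw [h.raise_lower_one, smul_eq_zero_iff_left h.v_ne] at this
    rw [h'.raise_lower_one, this, zero_smul]
  · exact h'.raise_eq_zero (by omega) f (h'.lower_mem b)

/-- An irreducible highest weight module has no singular vectors of degree `-1`. -/
lemma eq_zero_of_singular (h : IsHWModule lam cc ρ g v) (hirr : IsIrreducibleGraded ρ g)
    {u : E} (hu : u ∈ g (-1))
    (hs : ∀ k : ℤ, 0 < k → ∀ f : Polynomial ℂ, ρ (Finsupp.single k f, 0) u = 0) : u = 0 := by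
  let Y : Submodule ℂ E := g (-1) ⊓
    ⨅ (k : ℤ) (_ : 0 < k) (f : Polynomial ℂ), LinearMap.ker (ρ (Finsupp.single k f, 0))
  have memY (w : E) : w ∈ Y ↔ w ∈ g (-1) ∧
      ∀ k : ℤ, 0 < k → ∀ f : Polynomial ℂ, ρ (Finsupp.single k f, 0) w = 0 := by
    simp [Y]
  obtain ⟨Q, hYQ, hQT, hQ⟩ := exists_invariant_le (Y := Y) (T := ⨆ (i : ℤ) (_ : i < 0), g i)
    h.rep
    (fun c w hw => by
      rw [memY] at hw ⊢
      refine ⟨h.central_mem c hw.1, fun k hk f => ?_⟩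
      have := action_comm h.rep (0, c) (Finsupp.single k f, 0) w
      rw [hatBracket_central_left, map_zero, LinearMap.zero_apply, add_zero, hw.2 k hk f,
        map_zero] at this
      exact this.symm)
    (fun l hl e w hw => by
      rw [memY] at hw ⊢
      rcases hl.eq_or_lt with rfl | hl
      · refine ⟨by simpa using h.mem_shift 0 e hw.1, fun k hk f => ?_⟩
        rw [action_comm h.rep, hw.2 k hk f, map_zero, zero_add,
          hatBracket_single_single_of_add_ne_zero (by omega), hw.2 _ (by omega)]
      · simp [hw.2 l hl e])
    (inf_le_left.trans (le_iSup₂_of_le (-1) (by norm_num) le_rfl))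
    (fun k hk f => by
      change (⨆ (i : ℤ) (_ : i < 0), g i) ≤
        (⨆ (i : ℤ) (_ : i < 0), g i).comap (ρ (Finsupp.single k f, 0))
      refine iSup₂_le fun i hi w hw => ?_
      exact Submodule.mem_iSup_of_mem (i + k)
        (Submodule.mem_iSup_of_mem (by omega) (h.mem_shift k f hw)))
  have hinv (x : DhatA) : ∀ w ∈ ⨆ j, Q ⊓ g j, ρ x w ∈ ⨆ j, Q ⊓ g j := by
    refine action_mem_of_homogeneous (fun k f => ?_) (fun c => ?_) x
    · change (⨆ j, Q ⊓ g j) ≤ (⨆ j, Q ⊓ g j).comap (ρ (Finsupp.single k f, 0))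
      exact iSup_le fun j w hw =>
        Submodule.mem_iSup_of_mem (j + k) ⟨hQ _ w hw.1, h.mem_shift k f hw.2⟩
    · change (⨆ j, Q ⊓ g j) ≤ (⨆ j, Q ⊓ g j).comap (ρ (0, c))
      exact iSup_le fun j w hw =>
        Submodule.mem_iSup_of_mem j ⟨hQ _ w hw.1, h.central_mem c hw.2⟩
  have hgr : (⨆ j, Q ⊓ g j) = ⨆ j, (⨆ i, Q ⊓ g i) ⊓ g j :=
    le_antisymm
      (iSup_mono fun j => le_inf (le_iSup (fun i => Q ⊓ g i) j) inf_le_right)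
      (iSup_le fun j => inf_le_left)
  have huY : u ∈ Y := (memY u).2 ⟨hu, hs⟩
  rcases hirr _ (fun x => Submodule.map_le_iff_le_comap.2 (hinv x)) hgr with hbot | htop
  · have : u ∈ ⨆ j, Q ⊓ g j := Submodule.mem_iSup_of_mem (-1) ⟨hYQ huY, hu⟩
    rwa [hbot, Submodule.mem_bot] at this
  · refine absurd ?_ h.v_ne
    have hv : v ∈ ⨆ j, Q ⊓ g j := htop ▸ Submodule.mem_top
    have hv' : v ∈ ⨆ (i : ℤ) (_ : i ≠ 0), g i :=
      (iSup_le fun j => inf_le_left.trans (hQT.trans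
        (iSup₂_mono' fun i hi => ⟨i, hi.ne, le_rfl⟩)) :
        (⨆ j, Q ⊓ g j) ≤ ⨆ (i : ℤ) (_ : i ≠ 0), g i) hv
    exact (Submodule.mem_bot ℂ).1 (h.indep 0 ▸ ⟨h.v_mem, hv'⟩)

end IsHWModule

namespace IsHWModule

variable {E : Type*} [AddCommGroup E] [Module ℂ E] {ρ : DhatA →ₗ[ℂ] Module.End ℂ E}
  {lam : Polynomial ℂ →ₗ[ℂ] ℂ} {cc : ℂ} {g : ℤ → Submodule ℂ E} {v : E}

open Polynomial in
/-- The polynomials `p` with `z^k p(D)·v = 0` form an ideal, for `k ≠ 0`. -/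
lemma mul_annihilates (h : IsHWModule lam cc ρ g v) {k : ℤ} (hk : k ≠ 0) {p : ℂ[X]}
    (hp : ρ (Finsupp.single k p, 0) v = 0) (f : ℂ[X]) :
    ρ (Finsupp.single k (p * f), 0) v = 0 := by
  have step (q : ℂ[X]) (hq : orbitMap ρ k v q = 0) : orbitMap ρ k v (X * q) = 0 := by
    have h₁ := action_comm h.rep (Finsupp.single 0 (X ^ 2), 0) (Finsupp.single k q, 0) v
    have h₂ : ((X : ℂ[X]) ^ 2).comp (X + C (k : ℂ)) * q - q.comp (X + C ((0 : ℤ) : ℂ)) * X ^ 2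
        = (2 * k : ℂ) • (X * q) + (k ^ 2 : ℂ) • q := by
      have hC : (C 2 : ℂ[X]) = 2 := map_ofNat C 2
      simp [smul_eq_C_mul, hC]
      ring
    rw [← orbitMap_apply k v, hq, map_zero, h.weight, map_smul, ← orbitMap_apply k v, hq,
      smul_zero, zero_add, hatBracket_single_single_of_add_ne_zero (by simpa using hk),
      zero_add, h₂, ← orbitMap_apply, map_add, map_smul, map_smul, hq, smul_zero, add_zero] at h₁
    exact (smul_eq_zero.1 h₁.symm).resolve_left (by simpa using hk)
  rw [← orbitMap_apply k v] at hp ⊢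
  induction f using Polynomial.induction_on' with
  | add a b ha hb => rw [mul_add, map_add, ha, hb, add_zero]
  | monomial n a =>
    rw [← C_mul_X_pow_eq_monomial, mul_left_comm, ← smul_eq_C_mul, map_smul]
    have : orbitMap ρ k v (p * X ^ n) = 0 := by
      induction n with
      | zero => simpa using hp
      | succ n ih => rw [pow_succ, ← mul_assoc, mul_comm]; exact step _ ih
    rw [this, smul_zero]

open Polynomial in
lemma exists_annihilator_highest_weight (h : IsHWModule lam cc ρ g v) {b : ℂ[X]} (hb : b ≠ 0)
    (hbv : ρ (Finsupp.single (-1) b, 0) v = 0) (n : ℕ) :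
    ∃ p : ℂ[X], p ≠ 0 ∧ ρ (Finsupp.single (-(n + 1 : ℤ)) p, 0) v = 0 := by
  induction n with
  | zero => exact ⟨b, hb, by simpa using hbv⟩
  | succ n ih =>
    obtain ⟨p, hp, hpv⟩ := ih
    set k : ℤ := -(n + 1 : ℤ) with hk
    have key (q : ℂ[X]) : ρ (Finsupp.single (-1 + k)
        (b.comp (X + C (k : ℂ)) * (p * q) - (p * q).comp (X + C ((-1 : ℤ) : ℂ)) * b), 0) v = 0 := by
      have := action_comm h.rep (Finsupp.single (-1) b, 0) (Finsupp.single k (p * q), 0) v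
      rwa [h.mul_annihilates (by omega) hpv, hbv, map_zero, map_zero, zero_add,
        hatBracket_single_single_of_add_ne_zero (by omega), eq_comm] at this
    have hidx : -((n + 1 : ℕ) + 1 : ℤ) = -1 + k := by push_cast; omega
    rw [hidx]
    by_contra! hcon
    have h₁ := not_imp_not.1 (hcon _) (key 1)
    have h₂ := not_imp_not.1 (hcon _) (key X)
    rw [mul_one] at h₁
    simp only [mul_comp, X_comp] at h₂
    have h₃ : b.comp (X + C (k : ℂ)) * p = 0 := by
      have hC : (C ((-1 : ℤ) : ℂ) : ℂ[X]) = -1 := by simp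
      rw [hC] at h₁ h₂
      linear_combination h₂ - (X - 1) * h₁
    exact mul_ne_zero (comp_X_add_C_ne_zero_iff.2 hb) hp h₃

open Polynomial in
lemma exists_annihilator (h : IsHWModule lam cc ρ g v) {b : ℂ[X]} (hb : b ≠ 0)
    (hbv : ρ (Finsupp.single (-1) b, 0) v = 0) (u : E) :
    ∀ k < (0 : ℤ), ∃ p : ℂ[X], p ≠ 0 ∧ ∀ f, ρ (Finsupp.single k (p * f), 0) u = 0 := by
  let T : Submodule ℂ E :=
    { carrier := {u | ∀ k < (0 : ℤ), ∃ p : ℂ[X], p ≠ 0 ∧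
        ∀ f, ρ (Finsupp.single k (p * f), 0) u = 0}
      zero_mem' := fun k _ => ⟨1, one_ne_zero, fun f => map_zero _⟩
      smul_mem' := fun t u hu k hk => by
        obtain ⟨p, hp, hpu⟩ := hu k hk
        exact ⟨p, hp, fun f => by rw [map_smul, hpu, smul_zero]⟩
      add_mem' := fun {u w} hu hw k hk => by
        obtain ⟨p, hp, hpu⟩ := hu k hk
        obtain ⟨q, hq, hqw⟩ := hw k hk
        refine ⟨p * q, mul_ne_zero hp hq, fun f => ?_⟩
        rw [map_add, mul_assoc, hpu, mul_left_comm, hqw, add_zero] }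
  suffices hT : T = ⊤ by
    have hu : u ∈ T := hT ▸ Submodule.mem_top
    exact hu
  refine h.eq_top_of_lower_stable (fun k hk => ?_) fun l hl e u hu k hk => ?_
  · obtain ⟨p, hp, hpv⟩ := h.exists_annihilator_highest_weight hb hbv (-k - 1).toNat
    have hidx : -(((-k - 1).toNat : ℤ) + 1) = k := by omega
    rw [hidx] at hpv
    exact ⟨p, hp, h.mul_annihilates hk.ne hpv⟩
  · obtain ⟨p, hp, hpu⟩ := hu k hk
    obtain ⟨q, hq, hqu⟩ := hu (k + l) (by omega)
    refine ⟨p * (q * q.comp (X + C (-(l : ℂ)))),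
      mul_ne_zero hp (mul_ne_zero hq (comp_X_add_C_ne_zero_iff.2 hq)), fun f => ?_⟩
    rw [action_comm h.rep, mul_assoc, hpu, map_zero, zero_add,
      hatBracket_single_single_of_add_ne_zero (by omega)]
    have hcomp : (q.comp (X + C (-(l : ℂ)))).comp (X + C (l : ℂ)) = q := by
      rw [comp_assoc]; simp
    have : (p * (q * q.comp (X + C (-(l : ℂ))) * f)).comp (X + C (l : ℂ)) * e -
        e.comp (X + C (k : ℂ)) * (p * (q * q.comp (X + C (-(l : ℂ))) * f)) =
        q * (p.comp (X + C (l : ℂ)) * q.comp (X + C (l : ℂ)) * f.comp (X + C (l : ℂ)) * e -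
          e.comp (X + C (k : ℂ)) * p * q.comp (X + C (-(l : ℂ))) * f) := by
      simp only [mul_comp, hcomp]
      ring
    rw [this, hqu]

open Polynomial in
lemma finiteDimensional_range_orbitMap {k : ℤ} {u : E} {p : ℂ[X]} (hp : p ≠ 0)
    (hpu : ∀ f, ρ (Finsupp.single k (p * f), 0) u = 0) :
    FiniteDimensional ℂ (LinearMap.range (orbitMap ρ k u)) := by
  have hle : LinearMap.range (orbitMap ρ k u) ≤
      (degreeLT ℂ p.natDegree).map (orbitMap ρ k u) := by
    rintro _ ⟨f, rfl⟩
    refine ⟨f % p, mem_degreeLT.2 ?_, ?_⟩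
    · rw [← degree_eq_natDegree hp]
      exact degree_mod_lt f hp
    · have h₁ : orbitMap ρ k u (p * (f / p) + f % p) = orbitMap ρ k u (f % p) := by
        rw [map_add, orbitMap_apply, hpu, zero_add]
      rw [← h₁, EuclideanDomain.div_add_mod]
  exact Submodule.finiteDimensional_of_le hle

lemma finiteDimensional_span_lower {k : ℤ} {U : Submodule ℂ E} [FiniteDimensional ℂ U]
    (hU : ∀ u : E, ∃ p : Polynomial ℂ, p ≠ 0 ∧ ∀ f, ρ (Finsupp.single k (p * f), 0) u = 0) :
    FiniteDimensional ℂ (Submodule.span ℂ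
      {y | ∃ f : Polynomial ℂ, ∃ u ∈ U, y = ρ (Finsupp.single k f, 0) u}) := by
  obtain ⟨s, hs⟩ := (Submodule.fg_iff_finiteDimensional U).2 ‹_›
  have hfin (u : E) : FiniteDimensional ℂ (LinearMap.range (orbitMap ρ k u)) := by
    obtain ⟨p, hp, hpu⟩ := hU u
    exact finiteDimensional_range_orbitMap hp hpu
  have hle : Submodule.span ℂ {y | ∃ f : Polynomial ℂ, ∃ u ∈ U, y = ρ (Finsupp.single k f, 0) u} ≤
      ⨆ u : s, LinearMap.range (orbitMap ρ k (u : E)) := by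
    refine Submodule.span_le.2 ?_
    rintro _ ⟨f, u, hu, rfl⟩
    have : U ≤ (⨆ u : s, LinearMap.range (orbitMap ρ k (u : E))).comap
        (ρ (Finsupp.single k f, 0)) := by
      rw [← hs, Submodule.span_le]
      exact fun w hw => Submodule.mem_iSup_of_mem ⟨w, hw⟩ ⟨f, rfl⟩
    exact this hu
  exact Submodule.finiteDimensional_of_le hle

lemma finiteDimensional (h : IsHWModule lam cc ρ g v) {b : Polynomial ℂ} (hb : b ≠ 0)
    (hbv : ρ (Finsupp.single (-1) b, 0) v = 0) (j : ℤ) : FiniteDimensional ℂ (g j) := by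
  rcases lt_or_ge 0 j with hj | hj
  · rw [h.posbot j hj]; infer_instance
  obtain ⟨n, rfl⟩ : ∃ n : ℕ, j = -n := ⟨(-j).toNat, by omega⟩
  clear hj
  induction n using Nat.strong_induction_on with
  | _ n ih =>
    rcases n.eq_zero_or_pos with rfl | hn
    · rw [Nat.cast_zero, neg_zero, h.v_span]; infer_instance
    · have hfin (i : Fin n) : FiniteDimensional ℂ (Submodule.span ℂ
          {y | ∃ f : Polynomial ℂ, ∃ u ∈ g (-(i : ℕ)),
            y = ρ (Finsupp.single ((i : ℤ) - n) f, 0) u}) := by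
        have := ih i i.2
        exact finiteDimensional_span_lower fun u =>
          h.exists_annihilator hb hbv u _ (by have := i.2; omega)
      refine Submodule.finiteDimensional_of_le (S₂ := ⨆ i : Fin n, Submodule.span ℂ
          {y | ∃ f : Polynomial ℂ, ∃ u ∈ g (-(i : ℕ)),
            y = ρ (Finsupp.single ((i : ℤ) - n) f, 0) u}) ?_
      rw [h.eq_span_lower (by omega), Submodule.span_le]
      rintro _ ⟨k, hk, f, u, hu, rfl⟩
      rcases lt_or_ge 0 (-(n : ℤ) - k) with hpos | hneg
      · rw [h.posbot _ hpos, Submodule.mem_bot] at hu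
        simp [hu]
      · refine Submodule.mem_iSup_of_mem ⟨(n + k).toNat, by omega⟩
          (Submodule.subset_span ⟨f, u, ?_, ?_⟩)
        · convert hu using 2
          simp only
          omega
        · have : (((n + k).toNat : ℕ) : ℤ) - n = k := by omega
          simp only [this]

end IsHWModule

/-! ### The action of `𝒟` on functions on an infinite Grassmannian

The subspaces of `ℂ[z, z⁻¹]` which are graphs over `⊕_{k≥m} ℂ z^k` form a chart around that
subspace, with coordinates `X (i, k)`, `i < m ≤ k`. The Lie algebra `𝒟` acts on it by the Riccati
vector fields. -/

section Riccati

/-- The value at `z^k` of the `i`-th coordinate functional vanishing on the generic subspace. -/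
noncomputable def chartForm (m i k : ℤ) : MvPolynomial (ℤ × ℤ) ℂ :=
  if k < m then (if k = i then 1 else 0) else MvPolynomial.X (i, k)

/-- The derivative of `chartForm m i k` along the vector field of `z^s f(D)`. -/
noncomputable def riccati (m s : ℤ) (f : Polynomial ℂ) (i k : ℤ) : MvPolynomial (ℤ × ℤ) ℂ :=
  ∑ l ∈ Finset.Ico (min i m - s) m, f.eval (l : ℂ) • (chartForm m i (l + s) * chartForm m l k) -
    f.eval (k : ℂ) • chartForm m i (k + s)

lemma chartForm_eq_zero {m i k : ℤ} (hk : k < min i m) : chartForm m i k = 0 := by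
  rw [chartForm, if_pos (by omega), if_neg (by omega)]

lemma riccati_eq_sum {m s i L : ℤ} (hL : L ≤ min i m - s) (f : Polynomial ℂ) (k : ℤ) :
    riccati m s f i k =
      ∑ l ∈ Finset.Ico L m, f.eval (l : ℂ) • (chartForm m i (l + s) * chartForm m l k) -
        f.eval (k : ℂ) • chartForm m i (k + s) := by
  rw [riccati]
  congr 1
  refine Finset.sum_subset (Finset.Ico_subset_Ico_left hL) fun l hl hl' => ?_
  rw [Finset.mem_Ico] at hl hl'
  rw [chartForm_eq_zero (by omega), zero_mul, smul_zero]

lemma riccati_of_lt {m k : ℤ} (hk : k < m) (s : ℤ) (f : Polynomial ℂ) (i : ℤ) :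
    riccati m s f i k = 0 := by
  rw [riccati_eq_sum (L := min k (min i m - s)) (min_le_right _ _), sub_eq_zero,
    Finset.sum_eq_single k]
  · simp [chartForm, hk]
  · intro l hl hlk
    simp [chartForm, hk, hlk.symm]
  · intro h
    rw [Finset.mem_Ico] at h
    omega

/-- The vector field of `z^s f(D)`, as a linear function of `f`. -/
noncomputable def riccatiField (m s : ℤ) :
    Polynomial ℂ →ₗ[ℂ] Derivation ℂ (MvPolynomial (ℤ × ℤ) ℂ) (MvPolynomial (ℤ × ℤ) ℂ) where
  toFun f := MvPolynomial.mkDerivation ℂ fun ik => riccati m s f ik.1 ik.2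
  map_add' f g := MvPolynomial.derivation_ext fun ik => by
    simp only [MvPolynomial.mkDerivation_X, Derivation.add_apply, riccati, Polynomial.eval_add,
      add_smul, Finset.sum_add_distrib]
    abel
  map_smul' c f := MvPolynomial.derivation_ext fun ik => by
    simp only [MvPolynomial.mkDerivation_X, Derivation.smul_apply, riccati, Polynomial.eval_smul,
      smul_assoc, ← Finset.smul_sum, smul_sub, RingHom.id_apply]

lemma riccatiField_X (m s : ℤ) (f : Polynomial ℂ) (ik : ℤ × ℤ) :
    riccatiField m s f (MvPolynomial.X ik) = riccati m s f ik.1 ik.2 :=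
  MvPolynomial.mkDerivation_X _ _ _

lemma riccatiField_chartForm (m s : ℤ) (f : Polynomial ℂ) (i k : ℤ) :
    riccatiField m s f (chartForm m i k) = riccati m s f i k := by
  by_cases hk : k < m
  · rw [riccati_of_lt hk, chartForm, if_pos hk]
    split_ifs <;> simp
  · rw [chartForm, if_neg hk, riccatiField_X]

lemma riccatiField_riccati (m : ℤ) {s t i L : ℤ} (f g : Polynomial ℂ) (k : ℤ)
    (hs : L ≤ min i m - s) (ht : L ≤ min i m - t) (hst : L ≤ min i m - s - t) :
    riccatiField m t g (riccati m s f i k) =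
      (f.eval (k : ℂ) * g.eval ((k + s : ℤ) : ℂ)) • chartForm m i (k + s + t)
      - ∑ l ∈ Finset.Ico L m, (f.eval (l : ℂ) * g.eval ((l + s : ℤ) : ℂ)) •
          (chartForm m i (l + s + t) * chartForm m l k)
      - (∑ l ∈ Finset.Ico L m, (f.eval (k : ℂ) * g.eval (l : ℂ)) •
            (chartForm m i (l + t) * chartForm m l (k + s)) +
          ∑ l ∈ Finset.Ico L m, (g.eval (k : ℂ) * f.eval (l : ℂ)) •
            (chartForm m i (l + s) * chartForm m l (k + t)))
      + (∑ l ∈ Finset.Ico L m, ∑ p ∈ Finset.Ico L m, (f.eval (l : ℂ) * g.eval (p : ℂ)) •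
            (chartForm m i (p + t) * chartForm m p (l + s) * chartForm m l k) +
          ∑ l ∈ Finset.Ico L m, ∑ p ∈ Finset.Ico L m, (g.eval (l : ℂ) * f.eval (p : ℂ)) •
            (chartForm m i (p + s) * chartForm m p (l + t) * chartForm m l k)) := by
  have hprod (l : ℤ) : chartForm m i (l + s) * riccati m t g l k =
      chartForm m i (l + s) * (∑ p ∈ Finset.Ico L m,
        g.eval (p : ℂ) • (chartForm m l (p + t) * chartForm m p k) -
          g.eval (k : ℂ) • chartForm m l (k + t)) := by
    by_cases hl : l + s < min i m
    · rw [chartForm_eq_zero hl, zero_mul, zero_mul]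
    · rw [riccati_eq_sum (L := min L (min l m - t)) (min_le_right _ _)]
      congr 2
      refine (Finset.sum_subset (Finset.Ico_subset_Ico_left (min_le_left _ _))
        fun p hp hp' => ?_).symm
      rw [Finset.mem_Ico] at hp hp'
      rw [chartForm_eq_zero (by omega), zero_mul, smul_zero]
  rw [riccati_eq_sum hs, map_sub, map_sum, Derivation.map_smul, riccatiField_chartForm,
    riccati_eq_sum ht]
  have hterm (l : ℤ) : riccatiField m t g
      (f.eval (l : ℂ) • (chartForm m i (l + s) * chartForm m l k)) =
      -((f.eval (l : ℂ) * g.eval ((l + s : ℤ) : ℂ)) •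
          (chartForm m i (l + s + t) * chartForm m l k))
      - (g.eval (k : ℂ) * f.eval (l : ℂ)) • (chartForm m i (l + s) * chartForm m l (k + t))
      + (∑ p ∈ Finset.Ico L m, (f.eval (l : ℂ) * g.eval (p : ℂ)) •
            (chartForm m i (p + t) * chartForm m p (l + s) * chartForm m l k) +
          ∑ p ∈ Finset.Ico L m, (g.eval (p : ℂ) * f.eval (l : ℂ)) •
            (chartForm m i (l + s) * chartForm m l (p + t) * chartForm m p k)) := by
    rw [Derivation.map_smul, Derivation.leibniz, smul_eq_mul, smul_eq_mul,
      riccatiField_chartForm, riccatiField_chartForm, riccati_eq_sum ht, hprod]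
    simp only [MvPolynomial.smul_eq_C_mul, map_mul, mul_sub, mul_add, Finset.mul_sum]
    have e₁ (p : ℤ) : MvPolynomial.C (f.eval (l : ℂ)) * (chartForm m i (l + s) *
        (MvPolynomial.C (g.eval (p : ℂ)) * (chartForm m l (p + t) * chartForm m p k))) =
        MvPolynomial.C (g.eval (p : ℂ)) * MvPolynomial.C (f.eval (l : ℂ)) *
            (chartForm m i (l + s) * chartForm m l (p + t) * chartForm m p k) := by ring
    have e₂ (p : ℤ) : MvPolynomial.C (f.eval (l : ℂ)) * (chartForm m l k *
        (MvPolynomial.C (g.eval (p : ℂ)) * (chartForm m i (p + t) * chartForm m p (l + s)))) =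
        MvPolynomial.C (f.eval (l : ℂ)) * MvPolynomial.C (g.eval (p : ℂ)) *
            (chartForm m i (p + t) * chartForm m p (l + s) * chartForm m l k) := by ring
    simp only [e₁, e₂]
    ring
  simp only [hterm, Finset.sum_add_distrib, Finset.sum_sub_distrib, Finset.sum_neg_distrib]
  rw [Finset.sum_comm (f := fun l p : ℤ => (g.eval (p : ℂ) * f.eval (l : ℂ)) •
    (chartForm m i (l + s) * chartForm m l (p + t) * chartForm m p k))]
  simp only [smul_sub, Finset.smul_sum, smul_smul]
  abel

open Polynomial in
lemma riccatiField_bracket (m s t : ℤ) (f g : ℂ[X]) (r : MvPolynomial (ℤ × ℤ) ℂ) :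
    riccatiField m (s + t) (f.comp (X + C (t : ℂ)) * g - g.comp (X + C (s : ℂ)) * f) r =
      riccatiField m t g (riccatiField m s f r) - riccatiField m s f (riccatiField m t g r) := by
  suffices h : riccatiField m (s + t) (f.comp (X + C (t : ℂ)) * g - g.comp (X + C (s : ℂ)) * f) =
      ⁅riccatiField m t g, riccatiField m s f⁆ by
    rw [h, Derivation.commutator_apply]
  refine MvPolynomial.derivation_ext fun ik => ?_
  obtain ⟨i, k⟩ := ik
  set L : ℤ := min i m - |s| - |t| with hL
  have h₁ := le_abs_self s
  have h₂ := le_abs_self t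
  have h₃ := abs_nonneg s
  have h₄ := abs_nonneg t
  rw [Derivation.commutator_apply, riccatiField_X, riccatiField_X, riccatiField_X,
    riccatiField_riccati m (L := L) f g k (by omega) (by omega) (by omega),
    riccatiField_riccati m (L := L) g f k (by omega) (by omega) (by omega),
    riccati_eq_sum (L := L) (by simp only; omega)]
  simp only [eval_sub, eval_mul, eval_comp, eval_add, eval_X, eval_C, Int.cast_add, sub_smul,
    Finset.sum_sub_distrib, ← add_assoc]
  have comm (a : ℤ) : a + t + s = a + s + t := by ring
  simp only [comm, mul_comm (f.eval ((_ : ℂ) + _)), mul_comm (g.eval ((_ : ℂ) + _))]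
  abel

/-- The vector field of an element of `𝒟`. -/
noncomputable def vectorField (m : ℤ) :
    (ℤ →₀ Polynomial ℂ) →ₗ[ℂ]
      Derivation ℂ (MvPolynomial (ℤ × ℤ) ℂ) (MvPolynomial (ℤ × ℤ) ℂ) :=
  Finsupp.lsum ℂ (riccatiField m)

lemma vectorField_single (m s : ℤ) (f : Polynomial ℂ) :
    vectorField m (Finsupp.single s f) = riccatiField m s f := by
  simp [vectorField]

lemma vectorField_bracket (m : ℤ) (x y : ℤ →₀ Polynomial ℂ) (r : MvPolynomial (ℤ × ℤ) ℂ) :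
    vectorField m (twMulD x y - twMulD y x) r =
      vectorField m y (vectorField m x r) - vectorField m x (vectorField m y r) := by
  induction x using Finsupp.induction_linear with
  | zero => simp [twMulD]
  | add a b ha hb =>
    rw [twMulD_add_left, twMulD_add_right, add_sub_add_comm, map_add, Derivation.add_apply, ha, hb,
      map_add, Derivation.add_apply, map_add, Derivation.add_apply]
    abel
  | single s f =>
    induction y using Finsupp.induction_linear with
    | zero => simp [twMulD]
    | add a b ha hb =>
      rw [twMulD_add_left, twMulD_add_right, add_sub_add_comm, map_add, Derivation.add_apply,
        ha, hb, map_add, Derivation.add_apply, Derivation.add_apply, map_add]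
      abel
    | single t g =>
      rw [twMulD_single_single, twMulD_single_single, add_comm t s, ← Finsupp.single_sub,
        vectorField_single, vectorField_single, vectorField_single, riccatiField_bracket]

/-- Evaluation at the base point of the chart. -/
noncomputable def evalBase : MvPolynomial (ℤ × ℤ) ℂ →ₐ[ℂ] ℂ := MvPolynomial.aeval 0

lemma evalBase_chartForm (m i k : ℤ) :
    evalBase (chartForm m i k) = if k < m ∧ k = i then 1 else 0 := by
  unfold chartForm evalBase
  rcases eq_or_ne k i with rfl | h₂ <;> by_cases h₁ : k < m <;> simp [*]

lemma evalBase_riccati_of_le {m k : ℤ} (hk : m ≤ k) (s : ℤ) (f : Polynomial ℂ) (i : ℤ) :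
    evalBase (riccati m s f i k) = if k + s < m ∧ k + s = i then -f.eval (k : ℂ) else 0 := by
  rw [riccati, map_sub, map_sum, Finset.sum_eq_zero, zero_sub]
  · rw [map_smul, evalBase_chartForm]
    split_ifs <;> simp
  · intro l _
    rw [map_smul, map_mul, evalBase_chartForm m l k, if_neg (by omega), mul_zero, smul_zero]

/-- The vector fields of nonnegative degree vanish at the base point. -/
lemma evalBase_riccatiField_of_nonneg (m : ℤ) {s : ℤ} (hs : 0 ≤ s) (f : Polynomial ℂ)
    (r : MvPolynomial (ℤ × ℤ) ℂ) : evalBase (riccatiField m s f r) = 0 := by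
  induction r using MvPolynomial.induction_on with
  | C a =>
    rw [← MvPolynomial.algebraMap_eq, Derivation.map_algebraMap, map_zero]
  | add p q hp hq => rw [map_add, map_add, hp, hq, add_zero]
  | mul_X p ik hp =>
    obtain ⟨i, k⟩ := ik
    have hX : evalBase (riccatiField m s f (MvPolynomial.X (i, k))) = 0 := by
      rw [riccatiField_X]
      rcases lt_or_ge k m with hk | hk
      · rw [riccati_of_lt hk, map_zero]
      · rw [evalBase_riccati_of_le hk, if_neg (by omega)]
    rw [Derivation.leibniz, map_add, smul_eq_mul, smul_eq_mul, map_mul, map_mul, hX, hp]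
    simp

end Riccati

section Twist

variable {M : Type*} [AddCommGroup M] [Module ℂ M]

/-- The action of `𝒟̂` on linear maps from functions on the Grassmannian chart to `M`. -/
noncomputable def chartHomAction (m : ℤ) (ρ : DhatA →ₗ[ℂ] Module.End ℂ M) :
    DhatA →ₗ[ℂ] Module.End ℂ (MvPolynomial (ℤ × ℤ) ℂ →ₗ[ℂ] M) :=
  LinearMap.mk₂ ℂ (fun x φ => ρ x ∘ₗ φ + φ ∘ₗ (vectorField m x.1).toLinearMap)
    (fun x y φ => LinearMap.ext fun r => by simp; abel)
    (fun c x φ => LinearMap.ext fun r => by simp)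
    (fun x φ ψ => LinearMap.ext fun r => by simp; abel)
    (fun c x φ => LinearMap.ext fun r => by simp)

lemma chartHomAction_apply (m : ℤ) (ρ : DhatA →ₗ[ℂ] Module.End ℂ M) (x : DhatA)
    (φ : MvPolynomial (ℤ × ℤ) ℂ →ₗ[ℂ] M) (r : MvPolynomial (ℤ × ℤ) ℂ) :
    chartHomAction m ρ x φ r = ρ x (φ r) + φ (vectorField m x.1 r) := rfl

lemma chartHomAction_hatBracket (m : ℤ) {ρ : DhatA →ₗ[ℂ] Module.End ℂ M}
    (hrep : ∀ x y : DhatA, ρ (hatBracket x y) = ρ x * ρ y - ρ y * ρ x) (x y : DhatA) :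
    chartHomAction m ρ (hatBracket x y) =
      chartHomAction m ρ x * chartHomAction m ρ y - chartHomAction m ρ y * chartHomAction m ρ x := by
  refine LinearMap.ext fun φ => LinearMap.ext fun r => ?_
  have h : vectorField m (hatBracket x y).1 r =
      vectorField m y.1 (vectorField m x.1 r) - vectorField m x.1 (vectorField m y.1 r) :=
    vectorField_bracket m x.1 y.1 r
  simp only [chartHomAction_apply, LinearMap.sub_apply, Module.End.mul_apply, hrep, h, map_sub,
    map_add]
  abel

/-- The evaluation at the base point of the chart, multiplied by `v`. -/
noncomputable def evalBaseSMul (v : M) : MvPolynomial (ℤ × ℤ) ℂ →ₗ[ℂ] M :=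
  evalBase.toLinearMap.smulRight v

lemma evalBaseSMul_apply (v : M) (r : MvPolynomial (ℤ × ℤ) ℂ) :
    evalBaseSMul v r = evalBase r • v := rfl

lemma chartHomAction_evalBaseSMul_of_nonneg (m : ℤ) (ρ : DhatA →ₗ[ℂ] Module.End ℂ M) (v : M)
    {k : ℤ} (hk : 0 ≤ k) (f : Polynomial ℂ) (a : ℂ) :
    chartHomAction m ρ (Finsupp.single k f, a) (evalBaseSMul v) =
      evalBaseSMul (ρ (Finsupp.single k f, a) v) := by
  refine LinearMap.ext fun r => ?_
  rw [chartHomAction_apply, vectorField_single, evalBaseSMul_apply, evalBaseSMul_apply,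
    evalBaseSMul_apply, evalBase_riccatiField_of_nonneg m hk, zero_smul, add_zero, map_smul]

lemma chartHomAction_evalBaseSMul_ne_zero (m : ℤ) {ρ : DhatA →ₗ[ℂ] Module.End ℂ M} {v : M}
    (hv : v ≠ 0) {b : Polynomial ℂ} (hb : b.eval (m : ℂ) ≠ 0)
    (hbv : ρ (Finsupp.single (-1) b, 0) v = 0) :
    chartHomAction m ρ (Finsupp.single (-1) b, 0) (evalBaseSMul v) ≠ 0 := by
  intro h
  have := LinearMap.congr_fun h (MvPolynomial.X (m - 1, m))
  rw [chartHomAction_apply, evalBaseSMul_apply, evalBaseSMul_apply, map_smul, hbv, smul_zero,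
    zero_add, vectorField_single, riccatiField_X, evalBase_riccati_of_le le_rfl,
    if_pos (by constructor <;> omega)] at this
  simp [hb, hv] at this

end Twist

open FreeAlgebra in
/-- A highest weight vector of a `𝒟̂`-module generates a highest weight module, which has a model
in the lowest universe. -/
lemma exists_isHWModule_of_highest_weight_vector {E : Type*} [AddCommGroup E] [Module ℂ E]
    {ρ : DhatA →ₗ[ℂ] Module.End ℂ E} {lam : Polynomial ℂ →ₗ[ℂ] ℂ} {cc : ℂ} {w : E}
    (hrep : ∀ x y : DhatA, ρ (hatBracket x y) = ρ x * ρ y - ρ y * ρ x)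
    (w_ne : w ≠ 0)
    (weight : ∀ (f : Polynomial ℂ) (a : ℂ),
      ρ (Finsupp.single 0 f, a) w = (lam f + a * cc) • w)
    (hw_ann : ∀ k : ℤ, 0 < k → ∀ f : Polynomial ℂ, ρ (Finsupp.single k f, 0) w = 0) :
    ∃ (N : Type) (_ : AddCommGroup N) (_ : Module ℂ N)
      (ρ' : DhatA →ₗ[ℂ] Module.End ℂ N) (g' : ℤ → Submodule ℂ N) (v' : N) (j : N →ₗ[ℂ] E),
      IsHWModule lam cc ρ' g' v' ∧ j v' = w ∧ ∀ x n, j (ρ' x n) = ρ x (j n) := by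
  let ev : FreeAlgebra ℂ DhatA →ₗ[ℂ] E :=
    (LinearMap.applyₗ w) ∘ₗ (lift ℂ (fun x => ρ x)).toLinearMap
  have ev_one : ev 1 = w := by simp [ev]
  have ev_mul (x : DhatA) (a : FreeAlgebra ℂ DhatA) : ev (ι ℂ x * a) = ρ x (ev a) := by
    simp [ev]
  let j : (FreeAlgebra ℂ DhatA ⧸ LinearMap.ker ev) →ₗ[ℂ] E :=
    (LinearMap.ker ev).liftQ ev le_rfl
  have j_mk (a : FreeAlgebra ℂ DhatA) : j (Submodule.Quotient.mk a) = ev a := rfl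
  have j_inj : Function.Injective j :=
    LinearMap.ker_eq_bot.1 (Submodule.ker_liftQ_eq_bot _ _ _ le_rfl)
  let act (x : DhatA) : Module.End ℂ (FreeAlgebra ℂ DhatA ⧸ LinearMap.ker ev) :=
    (LinearMap.ker ev).mapQ (LinearMap.ker ev) (LinearMap.mulLeft ℂ (ι ℂ x)) fun a ha => by
      rw [LinearMap.mem_ker] at ha
      rw [Submodule.mem_comap, LinearMap.mulLeft_apply, LinearMap.mem_ker, ev_mul, ha, map_zero]
  have act_mk (x : DhatA) (a : FreeAlgebra ℂ DhatA) :
      act x (Submodule.Quotient.mk a) = Submodule.Quotient.mk (ι ℂ x * a) := rfl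
  have j_act (x : DhatA) (n) : j (act x n) = ρ x (j n) := by
    obtain ⟨a, rfl⟩ := Submodule.Quotient.mk_surjective _ n
    rw [act_mk, j_mk, j_mk, ev_mul]
  let ρ' : DhatA →ₗ[ℂ] Module.End ℂ (FreeAlgebra ℂ DhatA ⧸ LinearMap.ker ev) :=
    { toFun := act
      map_add' := fun x y => LinearMap.ext fun n => j_inj <| by
        simp only [j_act, map_add, LinearMap.add_apply]
      map_smul' := fun c x => LinearMap.ext fun n => j_inj <| by
        simp only [j_act, map_smul, LinearMap.smul_apply, RingHom.id_apply] }
  have j_ρ' (x : DhatA) (n) : j (ρ' x n) = ρ x (j n) := j_act x n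
  have j_one : j (Submodule.Quotient.mk 1) = w := ev_one
  refine ⟨_, _, _, ρ', _, Submodule.Quotient.mk 1, j, isHWModule_eigenspace
    (fun x y => LinearMap.ext fun n => j_inj ?_) (fun h => w_ne ?_) (fun f a => j_inj ?_)
    (fun k hk f => j_inj ?_) (fun W hW hinv => ?_), j_one, j_ρ'⟩
  · simp only [j_ρ', hrep, LinearMap.sub_apply, Module.End.mul_apply, map_sub]
  · rw [← j_one, h, map_zero]
  · rw [j_ρ', map_smul, j_one, weight]
  · rw [j_ρ', j_one, hw_ann k hk, map_zero]
  · have key (a : FreeAlgebra ℂ DhatA) : ∀ y : FreeAlgebra ℂ DhatA,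
        Submodule.Quotient.mk y ∈ W → Submodule.Quotient.mk (a * y) ∈ W := by
      induction a using FreeAlgebra.induction with
      | grade0 c =>
        intro y hy
        rw [← Algebra.smul_def, Submodule.Quotient.mk_smul]
        exact W.smul_mem c hy
      | grade1 x => exact fun y hy => hinv x (Submodule.mem_map_of_mem (f := ρ' x) hy)
      | mul a b ha hb => exact fun y hy => by rw [mul_assoc]; exact ha _ (hb y hy)
      | add a b ha hb =>
        intro y hy
        rw [add_mul, Submodule.Quotient.mk_add]
        exact W.add_mem (ha y hy) (hb y hy)
    refine Submodule.eq_top_iff'.2 fun n => ?_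
    obtain ⟨a, rfl⟩ := Submodule.Quotient.mk_surjective _ n
    simpa using key a 1 hW

lemma exists_int_eval_ne_zero {b : Polynomial ℂ} (hb : b ≠ 0) :
    ∃ m : ℤ, b.eval (m : ℂ) ≠ 0 := by
  by_contra! h
  refine hb (Polynomial.eq_zero_of_infinite_isRoot b
    ((Set.infinite_range_of_injective (Int.cast_injective (α := ℂ))).mono ?_))
  rintro _ ⟨m, rfl⟩
  exact h m

/-- If `z^{-1}b(D)·v = 0` with `b ≠ 0`, some highest weight module of the same highest weight has
a nonzero singular vector of degree `-1`. -/
lemma IsHWModule.exists_highly_degenerate {M : Type*} [AddCommGroup M] [Module ℂ M]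
    {lam : Polynomial ℂ →ₗ[ℂ] ℂ} {cc : ℂ} {ρ : DhatA →ₗ[ℂ] Module.End ℂ M}
    {g : ℤ → Submodule ℂ M} {v : M} (h : IsHWModule lam cc ρ g v) {b : Polynomial ℂ} (hb : b ≠ 0)
    (hbv : ρ (Finsupp.single (-1) b, 0) v = 0) :
    ∃ (N : Type) (_ : AddCommGroup N) (_ : Module ℂ N)
      (ρ' : DhatA →ₗ[ℂ] Module.End ℂ N) (g' : ℤ → Submodule ℂ N) (v' : N),
      IsHWModule lam cc ρ' g' v' ∧
      ∃ u : N, u ∈ g' (-1) ∧ u ≠ 0 ∧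
        ∀ k : ℤ, 0 < k → ∀ f : Polynomial ℂ, ρ' (Finsupp.single k f, 0) u = 0 := by
  obtain ⟨m, hm⟩ := exists_int_eval_ne_zero hb
  obtain ⟨N, _, _, ρ', g', v', j, h', hj, hjρ⟩ := exists_isHWModule_of_highest_weight_vector
    (w := evalBaseSMul v) (lam := lam) (cc := cc) (chartHomAction_hatBracket m h.rep)
    (fun h₀ => h.v_ne (by
      have := LinearMap.congr_fun h₀ 1
      simpa [evalBaseSMul_apply] using this))
    (fun f a => by
      rw [chartHomAction_evalBaseSMul_of_nonneg m ρ v le_rfl, h.weight]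
      exact LinearMap.ext fun r => by
        rw [LinearMap.smul_apply, evalBaseSMul_apply, evalBaseSMul_apply, smul_comm])
    (fun k hk f => by
      rw [chartHomAction_evalBaseSMul_of_nonneg m ρ v hk.le, h.hw_ann k hk]
      exact LinearMap.ext fun r => by simp [evalBaseSMul_apply])
  refine ⟨N, _, _, ρ', g', v', h', ρ' (Finsupp.single (-1) b, 0) v', h'.lower_mem b,
    fun h₀ => chartHomAction_evalBaseSMul_ne_zero m h.v_ne hm hbv ?_,
    h.singular_of_singular h' fun k hk f => by rw [hbv, map_zero]⟩
  rw [← hj, ← hjρ, h₀, map_zero]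

lemma IsHWModule.exists_monic_annihilator {M : Type*} [AddCommGroup M] [Module ℂ M]
    {lam : Polynomial ℂ →ₗ[ℂ] ℂ} {cc : ℂ} {ρ : DhatA →ₗ[ℂ] Module.End ℂ M}
    {g : ℤ → Submodule ℂ M} {v : M} (h : IsHWModule lam cc ρ g v) {b : Polynomial ℂ} (hb : b ≠ 0)
    (hbv : ρ (Finsupp.single (-1) b, 0) v = 0) :
    ∃ b : Polynomial ℂ, b.Monic ∧ ρ (Finsupp.single (-1 : ℤ) b, 0) v = 0 :=
  ⟨_, Polynomial.monic_mul_leadingCoeff_inv hb, h.mul_annihilates (by norm_num) hbv _⟩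

/-- Equivalence, for an irreducible highest weight `𝒟̂`-module `V` with highest weight
`λ`: (i) the Verma module `M(λ)` is highly degenerate, i.e. there is a highest weight
module with highest weight `λ` containing a nonzero singular vector of degree `−1`
(a vector killed by `𝒟̂_+`; any such vector lifts to one in `M(λ)`);
(ii) `V` is quasifinite; (iii) `(z^{-1}b(D))·v_λ = 0` for some monic `b ∈ ℂ[w]`. -/
theorem quasifinite_iff_highly_degenerate_iff_char_poly
    {M : Type*} [AddCommGroup M] [Module ℂ M]
    (lam : Polynomial ℂ →ₗ[ℂ] ℂ) (cc : ℂ)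
    (ρ : DhatA →ₗ[ℂ] Module.End ℂ M) (g : ℤ → Submodule ℂ M) (v : M)
    (hhw : IsHWModule lam cc ρ g v) (hirr : IsIrreducibleGraded ρ g) :
    -- (i) ↔ (ii)
    ((∃ (N : Type) (_ : AddCommGroup N) (_ : Module ℂ N)
        (ρ' : DhatA →ₗ[ℂ] Module.End ℂ N) (g' : ℤ → Submodule ℂ N) (v' : N),
        IsHWModule lam cc ρ' g' v' ∧
        ∃ u : N, u ∈ g' (-1) ∧ u ≠ 0 ∧
          ∀ k : ℤ, 0 < k → ∀ f : Polynomial ℂ, ρ' (Finsupp.single k f, 0) u = 0)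
      ↔ (∀ j : ℤ, FiniteDimensional ℂ ↥(g j))) ∧
    -- (ii) ↔ (iii)
    ((∀ j : ℤ, FiniteDimensional ℂ ↥(g j))
      ↔ ∃ b : Polynomial ℂ, b.Monic ∧ ρ (Finsupp.single (-1 : ℤ) b, 0) v = 0) := by
  have hdeg : (∀ j : ℤ, FiniteDimensional ℂ ↥(g j)) →
      ∃ b : Polynomial ℂ, b.Monic ∧ ρ (Finsupp.single (-1 : ℤ) b, 0) v = 0 := by
    intro hfin
    have := hfin (-1)
    let L : Polynomial ℂ →ₗ[ℂ] g (-1) :=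
      (IsHWModule.orbitMap ρ (-1) v).codRestrict (g (-1)) hhw.lower_mem
    have hL : ¬ Function.Injective L := fun hinj =>
      Polynomial.not_finite (Module.Finite.of_injective L hinj)
    obtain ⟨b, hbL, hb⟩ := (Submodule.ne_bot_iff _).1 (mt LinearMap.ker_eq_bot.1 hL)
    exact hhw.exists_monic_annihilator hb (congrArg Subtype.val hbL)
  have hfin : (∃ b : Polynomial ℂ, b.Monic ∧ ρ (Finsupp.single (-1 : ℤ) b, 0) v = 0) →
      ∀ j : ℤ, FiniteDimensional ℂ ↥(g j) :=
    fun ⟨_, hb, hbv⟩ => hhw.finiteDimensional hb.ne_zero hbv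
  refine ⟨⟨?_, fun h => ?_⟩, hdeg, hfin⟩
  · rintro ⟨N, _, _, ρ', g', v', h', u, hu, hu₀, hs⟩
    obtain ⟨b, rfl⟩ := h'.exists_of_mem_neg_one hu
    have hb : b ≠ 0 := by
      rintro rfl
      exact hu₀ (map_zero (IsHWModule.orbitMap ρ' (-1) v'))
    exact hfin (hhw.exists_monic_annihilator hb (hhw.eq_zero_of_singular hirr (hhw.lower_mem b)
      (h'.singular_of_singular hhw hs)))
  · obtain ⟨b, hb, hbv⟩ := hdeg h
    exact hhw.exists_highly_degenerate hb.ne_zero hbv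
end
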